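/- arXiv:1809.09793 — 5 statements merged into one kernel-verified Lean document; each statement's English description precedes it below -/
import Mathlib

section
/- Let μ and ν be probability measures on ℝ with finite first moments and cumulative distribution functions F and G respectively. Then the energy distance satisfies T(μ,ν;1) = 2∫∫|x−y| dμ(x)dν(y) − ∫∫|x−y| dμ(x)dμ(y) − ∫∫|x−y| dν(x)dν(y) = 2 ∫_ℝ (F(x) − G(x))² dx. -/
open MeasureTheory ProbabilityTheory
open scoped ENNReal

lemma energy_aux_cdf (μ : Measure ℝ) [IsProbabilityMeasure μ] (t : ℝ) :
    ∫ x, (Set.Iic t).indicator (fun _ => (1 : ℝ)) x ∂μ = cdf μ t := by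
  rw [integral_indicator_const _ measurableSet_Iic, cdf_eq_real]
  simp

lemma energy_aux_pt (x y t : ℝ) :
    (Set.Iic t).indicator (fun _ => (1 : ℝ)) x + (Set.Iic t).indicator (fun _ => (1 : ℝ)) y
      - 2 * ((Set.Iic t).indicator (fun _ => (1 : ℝ)) x *
        (Set.Iic t).indicator (fun _ => (1 : ℝ)) y)
      = (Set.Ico (min x y) (max x y)).indicator (fun _ => (1 : ℝ)) t := by
  simp only [Set.indicator_apply, Set.mem_Iic, Set.mem_Ico, min_le_iff, lt_max_iff]
  by_cases h1 : x ≤ t <;> by_cases h2 : y ≤ t <;>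
    simp [h1, h2, not_le.mp, not_lt.mpr] <;> norm_num

lemma energy_aux (μ ν : Measure ℝ) [IsProbabilityMeasure μ] [IsProbabilityMeasure ν]
    (hμ : Integrable (fun x => |x|) μ) (hν : Integrable (fun x => |x|) ν) :
    Integrable (fun t => cdf μ t + cdf ν t - 2 * (cdf μ t * cdf ν t)) ∧
    ∫ x, ∫ y, |x - y| ∂ν ∂μ = ∫ t, (cdf μ t + cdf ν t - 2 * (cdf μ t * cdf ν t)) := by
  have hm : Measurable (fun x : ℝ => x) := measurable_id
  have iμ : Integrable (fun x : ℝ => x) μ :=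
    (integrable_norm_iff hm.aestronglyMeasurable).1 (by simpa using hμ)
  have iν : Integrable (fun x : ℝ => x) ν :=
    (integrable_norm_iff hm.aestronglyMeasurable).1 (by simpa using hν)
  have iabs : Integrable (fun p : ℝ × ℝ => |p.1 - p.2|) (μ.prod ν) :=
    ((iμ.comp_fst ν).sub (iν.comp_snd μ)).abs
  let K : (ℝ × ℝ) → ℝ → ℝ := fun p t =>
    (Set.Ico (min p.1 p.2) (max p.1 p.2)).indicator (fun _ => (1 : ℝ)) t
  have hK1 : ∀ p, ∫ t, K p t = |p.1 - p.2| := by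
    intro p
    simp only [K]
    rw [integral_indicator_const _ measurableSet_Ico]
    simp [max_sub_min_eq_abs, abs_sub_comm]
  have hKm : Measurable (Function.uncurry K) := by
    have : Function.uncurry K = Set.indicator
        {q : (ℝ × ℝ) × ℝ | min q.1.1 q.1.2 ≤ q.2 ∧ q.2 < max q.1.1 q.1.2} (fun _ => (1 : ℝ)) := by
      ext q
      simp [Function.uncurry, K, Set.indicator_apply]
    rw [this]
    refine measurable_const.indicator ?_
    have m1 : Measurable (fun q : (ℝ × ℝ) × ℝ => min q.1.1 q.1.2) := by fun_prop
    have m2 : Measurable (fun q : (ℝ × ℝ) × ℝ => max q.1.1 q.1.2) := by fun_prop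
    exact (measurableSet_le m1 measurable_snd).inter (measurableSet_lt measurable_snd m2)
  have hKn : ∀ p t, ‖K p t‖ = K p t := by
    intro p t
    exact Real.norm_of_nonneg (Set.indicator_nonneg (fun _ _ => zero_le_one) _)
  have hKi : Integrable (Function.uncurry K) ((μ.prod ν).prod volume) := by
    rw [integrable_prod_iff hKm.aestronglyMeasurable]
    refine ⟨Filter.Eventually.of_forall fun p => ?_, ?_⟩
    · simp only [Function.uncurry, K]
      exact (integrable_indicator_iff measurableSet_Ico).2 (by simp [integrableOn_const_iff])
    · simpa only [Function.uncurry, hKn, hK1] using iabs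
  have hK2 : ∀ t, ∫ p, K p t ∂(μ.prod ν) = cdf μ t + cdf ν t - 2 * (cdf μ t * cdf ν t) := by
    intro t
    have ia : ∀ (ρ : Measure ℝ) [IsProbabilityMeasure ρ],
        Integrable ((Set.Iic t).indicator (fun _ => (1 : ℝ))) ρ := fun ρ _ =>
      (integrable_const _).indicator measurableSet_Iic
    simp only [K, ← energy_aux_pt]
    have iadd : Integrable (fun p : ℝ × ℝ => (Set.Iic t).indicator (fun _ => (1 : ℝ)) p.1
        + (Set.Iic t).indicator (fun _ => (1 : ℝ)) p.2) (μ.prod ν) :=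
      ((ia μ).comp_fst ν).add ((ia ν).comp_snd μ)
    rw [integral_sub iadd
      (((ia μ).mul_prod (ia ν)).const_mul 2),
      integral_add ((ia μ).comp_fst ν) ((ia ν).comp_snd μ), integral_const_mul,
      integral_prod_mul, integral_fun_fst, integral_fun_snd]
    simp [cdf_eq_real]
  constructor
  · have := hKi.integral_prod_right
    simpa only [Function.uncurry, hK2] using this
  · rw [integral_integral (f := fun x y => |x - y|) iabs]
    simp only [← hK1, ← hK2]
    exact integral_integral_swap hKi

/-- For probability measures `μ, ν` on `ℝ` with finite first moments and
CDFs `F, G`, the energy distance satisfies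
`T(μ,ν;1) = 2∫∫|x−y| dμ dν − ∫∫|x−y| dμ dμ − ∫∫|x−y| dν dν = 2 ∫ (F(x) − G(x))² dx`. -/
theorem energy_distance_eq_cdf_L2
    (μ ν : Measure ℝ) [IsProbabilityMeasure μ] [IsProbabilityMeasure ν]
    (hμ : Integrable (fun x => |x|) μ) (hν : Integrable (fun x => |x|) ν) :
    2 * (∫ x, ∫ y, |x - y| ∂ν ∂μ) - (∫ x, ∫ y, |x - y| ∂μ ∂μ)
        - (∫ x, ∫ y, |x - y| ∂ν ∂ν)
      = 2 * ∫ x, (cdf μ x - cdf ν x) ^ 2 := by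
  obtain ⟨i1, e1⟩ := energy_aux μ ν hμ hν
  obtain ⟨i2, e2⟩ := energy_aux μ μ hμ hμ
  obtain ⟨i3, e3⟩ := energy_aux ν ν hν hν
  have i12 : Integrable (fun t => 2 * (cdf μ t + cdf ν t - 2 * (cdf μ t * cdf ν t))
      - (cdf μ t + cdf μ t - 2 * (cdf μ t * cdf μ t))) := (i1.const_mul 2).sub i2
  rw [e1, e2, e3, ← integral_const_mul, ← integral_const_mul,
    ← integral_sub (i1.const_mul 2) i2, ← integral_sub i12 i3]
  congr 1
  ext t
  ring
end

section
/- Let K ≥ 2, let p_1,…,p_K > 0 with Σ_{k=1}^K p_k = 1, let μ_1,…,μ_K be probability measures on ℝ with cumulative distribution functions F_1,…,F_K, let μ := Σ_{k=1}^K p_k μ_k have cumulative distribution function F, and assume 0 < ∫_ℝ F(x)(1 − F(x)) dx < ∞. Then Σ_{k=1}^K p_k ∫_ℝ (F_k(x) − F(x))² dx = ∫_ℝ F(x)(1 − F(x)) dx holds if and only if every μ_k is a Dirac measure, i.e., for each k there exists c_k ∈ ℝ with μ_k = δ_{c_k}. -/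
open MeasureTheory ProbabilityTheory
open scoped ENNReal BigOperators

open Filter Topology Set

lemma aux_cdf_dirac (c x : ℝ) : cdf (Measure.dirac c) x = if c ≤ x then 1 else 0 := by
  rw [cdf_eq_real, measureReal_def, Measure.dirac_apply' _ measurableSet_Iic]
  by_cases h : c ≤ x <;> simp [h]

lemma aux_tendsto_right (μ : Measure ℝ) (x : ℝ) :
    Tendsto (cdf μ) (𝓝[>] x) (𝓝 (cdf μ x)) :=
  ((cdf μ).right_continuous x).tendsto.mono_left (nhdsWithin_mono _ Ioi_subset_Ici_self)

lemma aux_dirac_of_zero_one (μ : Measure ℝ) [IsProbabilityMeasure μ]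
    (h : ∀ x, cdf μ x = 0 ∨ cdf μ x = 1) : ∃ c : ℝ, μ = Measure.dirac c := by
  set S : Set ℝ := {x | cdf μ x = 1} with hS
  have hne : S.Nonempty := by
    obtain ⟨x, hx⟩ := ((tendsto_cdf_atTop μ).eventually (lt_mem_nhds zero_lt_one)).exists
    exact ⟨x, (h x).resolve_left hx.ne'⟩
  have hbd : BddBelow S := by
    obtain ⟨x, hx⟩ := ((tendsto_cdf_atBot μ).eventually (gt_mem_nhds zero_lt_one)).exists
    refine ⟨x, fun y hy => ?_⟩
    by_contra! hlt
    have h1 := monotone_cdf μ hlt.le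
    have h2 : cdf μ y = 1 := hy
    linarith
  refine ⟨sInf S, Measure.eq_of_cdf _ _ ?_⟩
  ext x
  rw [aux_cdf_dirac]
  split_ifs with hx
  · refine tendsto_nhds_unique (aux_tendsto_right μ x) ?_
    refine tendsto_const_nhds.congr' ?_
    filter_upwards [self_mem_nhdsWithin] with y hy
    obtain ⟨z, hz, hzy⟩ := exists_lt_of_csInf_lt hne (lt_of_le_of_lt hx hy)
    have h1 := monotone_cdf μ hzy.le
    have h2 : cdf μ z = 1 := hz
    linarith [cdf_le_one μ y]
  · refine (h x).resolve_right fun h1 => hx (csInf_le hbd h1)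

lemma aux_zero_one_of_ae (μ : Measure ℝ)
    (h : ∀ᵐ x, cdf μ x * (1 - cdf μ x) = 0) (x : ℝ) : cdf μ x = 0 ∨ cdf μ x = 1 := by
  by_contra! hx
  have hg : Tendsto (fun y => cdf μ y * (1 - cdf μ y)) (𝓝[>] x)
      (𝓝 (cdf μ x * (1 - cdf μ x))) :=
    (aux_tendsto_right μ x).mul (tendsto_const_nhds.sub (aux_tendsto_right μ x))
  have hne : cdf μ x * (1 - cdf μ x) ≠ 0 :=
    mul_ne_zero hx.1 (sub_ne_zero.2 hx.2.symm)
  have he := hg.eventually_ne hne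
  obtain ⟨u, hu, hsub⟩ := mem_nhdsGT_iff_exists_Ioo_subset.1 he
  have h0 : volume (Ioo x u) = 0 := measure_mono_null hsub h
  rw [Real.volume_Ioo, ENNReal.ofReal_eq_zero] at h0
  have : x < u := hu
  linarith

/-- For a mixture `μ = Σ p_k μ_k` of probability measures on `ℝ` with
`0 < ∫ F(1 − F) < ∞`, equality `Σ p_k ∫ (F_k − F)² = ∫ F(1 − F)` holds if and only if every
component `μ_k` is a Dirac point mass. -/
theorem mixture_between_variation_eq_total_iff_dirac
    (K : ℕ) (hK : 2 ≤ K) (p : Fin K → ℝ) (hp : ∀ k, 0 < p k) (hsum : ∑ k, p k = 1)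
    (μs : Fin K → Measure ℝ) [∀ k, IsProbabilityMeasure (μs k)]
    (hfin : Integrable
      (fun x => cdf (∑ j, ENNReal.ofReal (p j) • μs j) x *
        (1 - cdf (∑ j, ENNReal.ofReal (p j) • μs j) x)) volume)
    (hpos : 0 < ∫ x, cdf (∑ j, ENNReal.ofReal (p j) • μs j) x *
        (1 - cdf (∑ j, ENNReal.ofReal (p j) • μs j) x)) :
    (∑ k, p k * ∫ x, (cdf (μs k) x - cdf (∑ j, ENNReal.ofReal (p j) • μs j) x) ^ 2
        = ∫ x, cdf (∑ j, ENNReal.ofReal (p j) • μs j) x *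
            (1 - cdf (∑ j, ENNReal.ofReal (p j) • μs j) x))
      ↔ ∀ k, ∃ c : ℝ, μs k = Measure.dirac c := by
  set μ : Measure ℝ := ∑ j, ENNReal.ofReal (p j) • μs j with hμ
  have hprob : IsProbabilityMeasure μ := by
    constructor
    simp only [hμ, Measure.finsetSum_apply, Measure.smul_apply, measure_univ, smul_eq_mul, mul_one]
    rw [← ENNReal.ofReal_sum_of_nonneg fun i _ => (hp i).le, hsum, ENNReal.ofReal_one]
  have hF : ∀ x, cdf μ x = ∑ k, p k * cdf (μs k) x := by
    intro x
    simp only [cdf_eq_real, measureReal_def]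
    simp only [hμ, Measure.finsetSum_apply, Measure.smul_apply, smul_eq_mul]
    rw [ENNReal.toReal_sum fun i _ => ENNReal.mul_ne_top ENNReal.ofReal_ne_top (measure_ne_top _ _)]
    exact Finset.sum_congr rfl fun i _ => by
      rw [ENNReal.toReal_mul, ENNReal.toReal_ofReal (hp i).le]
  have hmeas : ∀ ν : Measure ℝ, Measurable (cdf ν) := fun ν => (monotone_cdf ν).measurable
  have hdec : ∀ x, cdf μ x * (1 - cdf μ x) = ∑ k, p k * (cdf (μs k) x - cdf μ x) ^ 2
      + ∑ k, p k * (cdf (μs k) x * (1 - cdf (μs k) x)) := by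
    intro x
    rw [← Finset.sum_add_distrib]
    have : ∀ k, p k * (cdf (μs k) x - cdf μ x) ^ 2 + p k * (cdf (μs k) x * (1 - cdf (μs k) x))
        = (p k * cdf (μs k) x) * (1 - 2 * cdf μ x) + p k * (cdf μ x) ^ 2 := fun k => by ring
    simp only [this]
    rw [Finset.sum_add_distrib, ← Finset.sum_mul, ← Finset.sum_mul, hsum, ← hF]
    ring
  have hn1 : ∀ k x, 0 ≤ p k * (cdf (μs k) x - cdf μ x) ^ 2 :=
    fun k x => mul_nonneg (hp k).le (sq_nonneg _)
  have hn0 : ∀ k x, 0 ≤ cdf (μs k) x * (1 - cdf (μs k) x) :=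
    fun k x => mul_nonneg (cdf_nonneg _ _) (sub_nonneg.2 (cdf_le_one _ _))
  have hn2 : ∀ k x, 0 ≤ p k * (cdf (μs k) x * (1 - cdf (μs k) x)) :=
    fun k x => mul_nonneg (hp k).le (hn0 k x)
  have hi1 : ∀ k, Integrable (fun x => p k * (cdf (μs k) x - cdf μ x) ^ 2) volume := by
    intro k
    refine hfin.mono' ((((hmeas _).sub (hmeas _)).pow_const 2).const_mul _).aestronglyMeasurable
      (ae_of_all _ fun x => ?_)
    rw [Real.norm_of_nonneg (hn1 k x), hdec x]
    have h1 := Finset.single_le_sum (fun i _ => hn1 i x) (Finset.mem_univ k)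
    have h2 := Finset.sum_nonneg fun i (_ : i ∈ Finset.univ) => hn2 i x
    linarith
  have hi2 : ∀ k, Integrable (fun x => p k * (cdf (μs k) x * (1 - cdf (μs k) x))) volume := by
    intro k
    refine hfin.mono' (((hmeas _).mul ((hmeas _).const_sub 1)).const_mul _).aestronglyMeasurable
      (ae_of_all _ fun x => ?_)
    rw [Real.norm_of_nonneg (hn2 k x), hdec x]
    have h1 := Finset.single_le_sum (fun i _ => hn2 i x) (Finset.mem_univ k)
    have h2 := Finset.sum_nonneg fun i (_ : i ∈ Finset.univ) => hn1 i x
    linarith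
  have hint : ∫ x, cdf μ x * (1 - cdf μ x) = (∑ k, p k * ∫ x, (cdf (μs k) x - cdf μ x) ^ 2)
      + ∑ k, ∫ x, p k * (cdf (μs k) x * (1 - cdf (μs k) x)) := by
    simp only [hdec]
    rw [integral_add (integrable_finsetSum _ fun k _ => hi1 k)
      (integrable_finsetSum _ fun k _ => hi2 k), integral_finsetSum _ fun k _ => hi1 k,
      integral_finsetSum _ fun k _ => hi2 k]
    simp only [integral_const_mul]
  rw [hint, left_eq_add, Finset.sum_eq_zero_iff_of_nonneg fun k _ => integral_nonneg (hn2 k)]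
  refine ⟨fun h k => ?_, fun h k _ => ?_⟩
  · have h1 := (integral_eq_zero_iff_of_nonneg (hn2 k) (hi2 k)).1 (h k (Finset.mem_univ k))
    refine aux_dirac_of_zero_one _ (aux_zero_one_of_ae _ ?_)
    filter_upwards [h1] with x hx
    exact (mul_eq_zero.1 hx).resolve_left (hp k).ne'
  · obtain ⟨c, hc⟩ := h k
    have : ∀ x, p k * (cdf (μs k) x * (1 - cdf (μs k) x)) = 0 := by
      intro x
      rw [hc, aux_cdf_dirac]
      split_ifs <;> simp
    simp only [this, integral_zero]
end

section
/- Let α > 0, let K ≥ 2, let p_1,…,p_K > 0 with Σ_{k=1}^K p_k = 1, let μ_1,…,μ_K be probability measures on ℝ^d each with finite α-th moment, and let μ := Σ_{k=1}^K p_k μ_k. Then Σ_{k=1}^K p_k T(μ_k,μ;α) = Σ_{1≤k<l≤K} p_k p_l T(μ_k,μ_l;α). -/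
open MeasureTheory ProbabilityTheory
open scoped ENNReal BigOperators

/-- The generalized Gini mean difference `Δ(μ,ν;α) = ∫∫ ‖x − y‖^α dμ(x) dν(y)`. -/
noncomputable def giniDelta {E : Type*} [NormedAddCommGroup E] [MeasurableSpace E]
    (α : ℝ) (μ ν : Measure E) : ℝ := ∫ x, ∫ y, ‖x - y‖ ^ α ∂ν ∂μ

/-- The energy distance `T(μ,ν;α) = 2Δ(μ,ν;α) − Δ(μ;α) − Δ(ν;α)`. -/
noncomputable def energyDist {E : Type*} [NormedAddCommGroup E] [MeasurableSpace E]
    (α : ℝ) (μ ν : Measure E) : ℝ :=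
  2 * giniDelta α μ ν - giniDelta α μ μ - giniDelta α ν ν

lemma gini_prod_integrable {d : ℕ} {α : ℝ} (hα : 0 < α)
    (μ ν : Measure (EuclideanSpace ℝ (Fin d))) [IsFiniteMeasure μ] [IsFiniteMeasure ν]
    (hμ : Integrable (fun x => ‖x‖ ^ α) μ) (hν : Integrable (fun x => ‖x‖ ^ α) ν) :
    Integrable (fun z : EuclideanSpace ℝ (Fin d) × EuclideanSpace ℝ (Fin d) =>
      ‖z.1 - z.2‖ ^ α) (μ.prod ν) := by
  have h1 := ((hμ.comp_fst ν).add (hν.comp_snd μ)).const_mul ((2 : ℝ) ^ α)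
  refine h1.mono' ?_ ?_
  · have : Continuous (fun z : EuclideanSpace ℝ (Fin d) × EuclideanSpace ℝ (Fin d) =>
      ‖z.1 - z.2‖ ^ α) :=
      (continuous_fst.sub continuous_snd).norm.rpow_const (fun _ => Or.inr hα.le)
    exact this.aestronglyMeasurable
  · refine Filter.Eventually.of_forall fun z => ?_
    have h0 : ‖z.1 - z.2‖ ≤ 2 * max ‖z.1‖ ‖z.2‖ := by
      have := norm_sub_le z.1 z.2
      have := le_max_left ‖z.1‖ ‖z.2‖
      have := le_max_right ‖z.1‖ ‖z.2‖
      linarith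
    have ha : 0 ≤ ‖z.1‖ ^ α := by positivity
    have hb : 0 ≤ ‖z.2‖ ^ α := by positivity
    rw [Real.norm_of_nonneg (by positivity)]
    calc ‖z.1 - z.2‖ ^ α ≤ (2 * max ‖z.1‖ ‖z.2‖) ^ α :=
          Real.rpow_le_rpow (norm_nonneg _) h0 hα.le
      _ = 2 ^ α * (max ‖z.1‖ ‖z.2‖) ^ α := Real.mul_rpow (by norm_num) (by positivity)
      _ ≤ 2 ^ α * (‖z.1‖ ^ α + ‖z.2‖ ^ α) := by
          gcongr
          rcases max_choice ‖z.1‖ ‖z.2‖ with h | h <;> rw [h] <;> linarith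

lemma gini_slice_integrable {d : ℕ} {α : ℝ} (hα : 0 < α)
    (ν : Measure (EuclideanSpace ℝ (Fin d))) [IsFiniteMeasure ν]
    (hν : Integrable (fun x => ‖x‖ ^ α) ν) (x : EuclideanSpace ℝ (Fin d)) :
    Integrable (fun y => ‖x - y‖ ^ α) ν := by
  have h := gini_prod_integrable hα (Measure.dirac x) ν
    (integrable_dirac (by simp [enorm_lt_top])) hν
  rw [Measure.dirac_prod] at h
  exact h.comp_measurable (by fun_prop)

lemma gini_comm {d : ℕ} {α : ℝ} (hα : 0 < α)
    (μ ν : Measure (EuclideanSpace ℝ (Fin d))) [IsFiniteMeasure μ] [IsFiniteMeasure ν]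
    (hμ : Integrable (fun x => ‖x‖ ^ α) μ) (hν : Integrable (fun x => ‖x‖ ^ α) ν) :
    giniDelta α μ ν = giniDelta α ν μ := by
  unfold giniDelta
  rw [integral_integral_swap (gini_prod_integrable hα μ ν hμ hν)]
  simp_rw [norm_sub_rev]

lemma integral_mix {E : Type*} [MeasurableSpace E] {K : ℕ} (p : Fin K → ℝ) (hp : ∀ k, 0 < p k)
    (μs : Fin K → Measure E) (f : E → ℝ) (hf : ∀ k, Integrable f (μs k)) :
    ∫ x, f x ∂(∑ j, ENNReal.ofReal (p j) • μs j) = ∑ j, p j * ∫ x, f x ∂(μs j) := by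
  rw [integral_finsetSum_measure (fun j _ => (hf j).smul_measure ENNReal.ofReal_ne_top)]
  refine Finset.sum_congr rfl fun j _ => ?_
  rw [integral_smul_measure, ENNReal.toReal_ofReal (hp j).le, smul_eq_mul]

/-- For a mixture `μ = Σ p_k μ_k` of probability measures on `ℝ^d` with finite
`α`-th moments, `Σ_k p_k T(μ_k,μ;α) = Σ_{k<l} p_k p_l T(μ_k,μ_l;α)`. -/
theorem weighted_energy_distance_eq_pairwise
    (d : ℕ) (α : ℝ) (hα : 0 < α)
    (K : ℕ) (hK : 2 ≤ K) (p : Fin K → ℝ) (hp : ∀ k, 0 < p k) (hsum : ∑ k, p k = 1)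
    (μs : Fin K → Measure (EuclideanSpace ℝ (Fin d))) [∀ k, IsProbabilityMeasure (μs k)]
    (hmom : ∀ k, Integrable (fun x => ‖x‖ ^ α) (μs k)) :
    ∑ k, p k * energyDist α (μs k) (∑ j, ENNReal.ofReal (p j) • μs j)
      = ∑ k, ∑ l, if k < l then p k * p l * energyDist α (μs k) (μs l) else 0 := by
  have hR : ∀ (x : EuclideanSpace ℝ (Fin d)),
      ∫ y, ‖x - y‖ ^ α ∂(∑ j, ENNReal.ofReal (p j) • μs j)
        = ∑ j, p j * ∫ y, ‖x - y‖ ^ α ∂(μs j) := fun x =>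
    integral_mix p hp μs _ fun k => gini_slice_integrable hα _ (hmom k) x
  have hI : ∀ k j, Integrable (fun x => ∫ y, ‖x - y‖ ^ α ∂(μs j)) (μs k) := fun k j =>
    (gini_prod_integrable hα _ _ (hmom k) (hmom j)).integral_prod_left
  have h1 : ∀ k, giniDelta α (μs k) (∑ j, ENNReal.ofReal (p j) • μs j)
      = ∑ j, p j * giniDelta α (μs k) (μs j) := by
    intro k
    unfold giniDelta
    simp_rw [hR]
    rw [integral_finsetSum _ (fun j _ => (hI k j).const_mul _)]
    simp_rw [integral_const_mul]
  have h2 : giniDelta α (∑ j, ENNReal.ofReal (p j) • μs j) (∑ j, ENNReal.ofReal (p j) • μs j)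
      = ∑ k, p k * ∑ j, p j * giniDelta α (μs k) (μs j) := by
    simp_rw [← h1]
    unfold giniDelta
    refine integral_mix p hp μs _ fun k => ?_
    simp_rw [hR]
    exact integrable_finsetSum _ (fun j _ => (hI k j).const_mul _)
  have hc : ∀ k l, giniDelta α (μs k) (μs l) = giniDelta α (μs l) (μs k) := fun k l =>
    gini_comm hα _ _ (hmom k) (hmom l)
  unfold energyDist
  simp_rw [h1, h2]
  generalize hD : (fun k l => giniDelta α (μs k) (μs l)) = D
  have hD' : ∀ k l, giniDelta α (μs k) (μs l) = D k l := fun k l => by rw [← hD]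
  simp_rw [hD'] at hc ⊢
  set S := ∑ k, p k * ∑ j, p j * D k j with hS
  set F : Fin K → Fin K → ℝ := fun k l => p k * p l * (2 * D k l - D k k - D l l) with hF
  have hL : ∑ k, p k * (2 * ∑ j, p j * D k j - D k k - S) = S - ∑ k, p k * D k k := by
    have : ∀ k, p k * (2 * ∑ j, p j * D k j - D k k - S)
        = 2 * (p k * ∑ j, p j * D k j) - p k * D k k - p k * S := fun k => by ring
    simp_rw [this, Finset.sum_sub_distrib, ← Finset.mul_sum, ← Finset.sum_mul, hsum, ← hS]
    ring
  have hFull : ∑ k, ∑ l, F k l = 2 * S - 2 * ∑ k, p k * D k k := by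
    have e : ∀ k l, F k l = 2 * (p k * (p l * D k l)) - (p k * D k k) * p l
        - p k * (p l * D l l) := fun k l => by simp only [hF]; ring
    simp_rw [e, Finset.sum_sub_distrib, ← Finset.mul_sum, ← Finset.sum_mul, hsum, ← hS]
    ring
  have hsplit : ∑ k, ∑ l, F k l = (∑ k, ∑ l, if k < l then F k l else 0)
      + ∑ k, ∑ l, if l < k then F k l else 0 := by
    simp_rw [← Finset.sum_add_distrib]
    refine Finset.sum_congr rfl fun k _ => Finset.sum_congr rfl fun l _ => ?_
    rcases lt_trichotomy k l with h | h | h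
    · simp [h, h.not_gt]
    · subst h
      simp only [hF, lt_irrefl, if_false]
      ring
    · simp [h, h.not_gt]
  have hsw : (∑ k, ∑ l, if l < k then F k l else 0) = ∑ k, ∑ l, if k < l then F k l else 0 := by
    rw [Finset.sum_comm]
    refine Finset.sum_congr rfl fun k _ => Finset.sum_congr rfl fun l _ => ?_
    have : F l k = F k l := by simp only [hF]; rw [hc l k]; ring
    rw [this]
  rw [hL]
  change _ = ∑ k, ∑ l, if k < l then F k l else 0
  linarith
end

section
/- Let 0 < α < 2, let K ≥ 2, let p_1,…,p_K > 0 with Σ_{k=1}^K p_k = 1, let μ_1,…,μ_K be probability measures on ℝ^d each with finite α-th moment, and let μ := Σ_{k=1}^K p_k μ_k. Then the Gini distance covariance gCov(α) := Δ(μ;α) − Σ_{k=1}^K p_k Δ(μ_k;α) equals 0 if and only if μ_k = μ for every k = 1,…,K; that is, ρ_g(α) = 0 characterizes independence of the numerical variable and the class label. -/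
open MeasureTheory ProbabilityTheory
open scoped ENNReal BigOperators

open GaussianFourier

theorem gini_lin1 {X : Type*} [MeasurableSpace X] {m : Measure X} {f g h : X → ℝ}
    (hf : Integrable f m) (hg : Integrable g m) (hh : Integrable h m) :
    ∫ x, (f x + g x - 2 * h x) ∂m = ∫ x, f x ∂m + ∫ x, g x ∂m - 2 * ∫ x, h x ∂m := by
  have h1 : Integrable (fun x => f x + g x) m := hf.add hg
  rw [integral_sub h1 (hh.const_mul 2), integral_add hf hg, integral_const_mul]

theorem gini_lin2 {X : Type*} [MeasurableSpace X] {m : Measure X} {f g h : X → ℝ}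
    (hf : Integrable f m) (hg : Integrable g m) (hh : Integrable h m) :
    ∫ x, (2 * f x - g x - h x) ∂m = 2 * ∫ x, f x ∂m - ∫ x, g x ∂m - ∫ x, h x ∂m := by
  have h1 : Integrable (fun x => 2 * f x - g x) m := (hf.const_mul 2).sub hg
  rw [integral_sub h1 hh, integral_sub (hf.const_mul 2) hg, integral_const_mul]

open Set Filter Complex in
theorem gini_scalar_base (α : ℝ) (hα : 0 < α) (hα2 : α < 2) :
    IntegrableOn (fun s : ℝ => (1 - Real.exp (-s ^ 2 / 2)) * s ^ (-1 - α)) (Ioi 0) := by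
  have hm : Measurable (fun s : ℝ => (1 - Real.exp (-s ^ 2 / 2)) * s ^ (-1 - α)) := by fun_prop
  rw [← Ioc_union_Ioi_eq_Ioi (zero_le_one' ℝ)]
  refine IntegrableOn.union ?_ ?_
  · have h1 : IntegrableOn (fun s : ℝ => s ^ (1 - α)) (Ioc 0 1) := by
      have := intervalIntegral.intervalIntegrable_rpow' (a := 0) (b := 1) (r := 1 - α) (by linarith)
      rwa [intervalIntegrable_iff_integrableOn_Ioc_of_le zero_le_one] at this
    refine Integrable.mono' h1 hm.aestronglyMeasurable ?_
    filter_upwards [ae_restrict_mem measurableSet_Ioc] with s hs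
    have hs0 : 0 < s := hs.1
    have h2 := Real.add_one_le_exp (-s ^ 2 / 2)
    have h3 : Real.exp (-s ^ 2 / 2) ≤ 1 := Real.exp_le_one_iff.2 (by nlinarith)
    rw [Real.norm_of_nonneg (mul_nonneg (by linarith) (by positivity))]
    have h4 : s ^ (1 - α) = s ^ 2 * s ^ (-1 - α) := by
      rw [← Real.rpow_natCast, ← Real.rpow_add hs0]; congr 1; push_cast; ring
    rw [h4]
    gcongr
    nlinarith
  · have h1 : IntegrableOn (fun s : ℝ => s ^ (-1 - α)) (Ioi 1) :=
      integrableOn_Ioi_rpow_of_lt (by linarith) zero_lt_one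
    refine Integrable.mono' h1 hm.aestronglyMeasurable ?_
    filter_upwards [ae_restrict_mem measurableSet_Ioi] with s hs
    have hs0 : 0 < s := lt_trans zero_lt_one hs
    have h3 : Real.exp (-s ^ 2 / 2) ≤ 1 := Real.exp_le_one_iff.2 (by nlinarith)
    rw [Real.norm_of_nonneg (mul_nonneg (by linarith) (by positivity))]
    have := Real.exp_pos (-s ^ 2 / 2)
    have h5 : 0 ≤ s ^ (-1 - α) := by positivity
    nlinarith

/-- the normalizing constant -/
noncomputable def giniC (α : ℝ) : ℝ :=
  ∫ s in Set.Ioi (0 : ℝ), (1 - Real.exp (-s ^ 2 / 2)) * s ^ (-1 - α)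

open Set Filter in
theorem gini_scalar (α : ℝ) (hα : 0 < α) (hα2 : α < 2) (r : ℝ) (hr : 0 ≤ r) :
    IntegrableOn (fun s : ℝ => (1 - Real.exp (-(s * r) ^ 2 / 2)) * s ^ (-1 - α)) (Ioi 0) ∧
    ∫ s in Ioi (0 : ℝ), (1 - Real.exp (-(s * r) ^ 2 / 2)) * s ^ (-1 - α) = giniC α * r ^ α := by
  rcases hr.eq_or_lt with rfl | hr
  · simp [Real.zero_rpow hα.ne']
  · set g : ℝ → ℝ := fun s => (1 - Real.exp (-s ^ 2 / 2)) * s ^ (-1 - α) with hg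
    have key : ∀ s ∈ Ioi (0 : ℝ), r ^ (1 + α) * g (r * s) =
        (1 - Real.exp (-(s * r) ^ 2 / 2)) * s ^ (-1 - α) := by
      intro s hs
      have hs0 : 0 < s := hs
      simp only [hg]
      rw [Real.mul_rpow hr.le hs0.le, mul_comm s r]
      have : r ^ (1 + α) * r ^ (-1 - α) = 1 := by
        rw [← Real.rpow_add hr]; simp
      linear_combination ((1 - Real.exp (-(r * s) ^ 2 / 2)) * s ^ (-1 - α)) * this
    have hgi := gini_scalar_base α hα hα2
    constructor
    · refine IntegrableOn.congr_fun (f := fun s => r ^ (1 + α) * g (r * s)) ?_ key measurableSet_Ioi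
      refine Integrable.const_mul ?_ _
      have := (integrableOn_Ioi_comp_mul_left_iff g 0 hr).2 (by simpa using hgi)
      exact this
    · rw [← setIntegral_congr_fun measurableSet_Ioi key, integral_const_mul,
        integral_comp_mul_left_Ioi g 0 hr, mul_zero, smul_eq_mul]
      have : r ^ (1 + α) = r * r ^ α := by rw [Real.rpow_add hr, Real.rpow_one]
      have h2 : giniC α = ∫ x in Ioi (0 : ℝ), g x := rfl
      rw [this, h2]
      field_simp

open Set Filter in
theorem giniC_pos (α : ℝ) (hα : 0 < α) (hα2 : α < 2) : 0 < giniC α := by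
  rw [giniC, setIntegral_pos_iff_support_of_nonneg_ae]
  · have : Ioi (0:ℝ) ⊆ Function.support
        (fun s : ℝ => (1 - Real.exp (-s ^ 2 / 2)) * s ^ (-1 - α)) := by
      intro s hs
      have hs0 : 0 < s := hs
      have h3 : Real.exp (-s ^ 2 / 2) < 1 := by
        rw [← Real.exp_zero]
        exact Real.exp_lt_exp.2 (by have := pow_pos hs0 2; linarith)
      have : 0 < s ^ (-1 - α) := by positivity
      exact (mul_pos (by linarith) this).ne'
    rw [inter_eq_self_of_subset_right this]
    simp
  · filter_upwards [ae_restrict_mem measurableSet_Ioi] with s hs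
    have hs0 : 0 < s := hs
    have h3 : Real.exp (-s ^ 2 / 2) ≤ 1 := Real.exp_le_one_iff.2 (by nlinarith)
    exact mul_nonneg (by linarith) (by positivity)
  · exact gini_scalar_base α hα hα2

section
variable {E : Type*} [NormedAddCommGroup E] [InnerProductSpace ℝ E] [FiniteDimensional ℝ E]
  [MeasurableSpace E] [BorelSpace E]

theorem gini_gauss_int : Integrable (fun t : E => Real.exp (-(1/2) * ‖t‖ ^ 2)) := by
  have := (integrable_cexp_neg_mul_sq_norm_add (V := E) (b := (1/2 : ℂ)) (by norm_num) 0 0).norm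
  refine this.congr (Filter.Eventually.of_forall fun t => ?_)
  simp only [Complex.norm_exp]
  congr 1
  simp [← Complex.ofReal_pow]

open Complex ComplexConjugate in
theorem gini_fourier (μ ν : Measure E) [IsProbabilityMeasure μ] [IsProbabilityMeasure ν] (s : ℝ) :
    (2 * Real.pi) ^ (Module.finrank ℝ E / 2 : ℝ) *
      ∫ z, Real.exp (-(s * ‖z.1 - z.2‖) ^ 2 / 2) ∂(μ.prod ν) =
    ∫ t : E, Real.exp (-(1/2) * ‖t‖ ^ 2) * (charFun μ (s • t) * conj (charFun ν (s • t))).re := by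
  set f : E × E → E → ℂ := fun z t =>
    cexp (-(1/2 : ℂ) * (‖t‖ : ℂ) ^ 2 + (s * I) * (inner ℝ (z.1 - z.2) t : ℝ)) with hf
  have hnorm : ∀ z t, ‖f z t‖ = Real.exp (-(1/2) * ‖t‖ ^ 2) := by
    intro z t
    simp only [hf, Complex.norm_exp]
    congr 1
    simp [← Complex.ofReal_pow]
  have hcont : Continuous (Function.uncurry f) := by
    simp only [hf, Function.uncurry_def]
    fun_prop
  have hint : Integrable (Function.uncurry f) ((μ.prod ν).prod volume) := by
    refine Integrable.mono' ((gini_gauss_int (E := E)).comp_snd (μ.prod ν))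
      hcont.aestronglyMeasurable (Filter.Eventually.of_forall fun p => ?_)
    exact (hnorm p.1 p.2).le
  have hsw := integral_integral_swap hint
  have hL : ∀ z, ∫ t, f z t =
      (((2 * Real.pi) ^ (Module.finrank ℝ E / 2 : ℝ) *
        Real.exp (-(s * ‖z.1 - z.2‖) ^ 2 / 2) : ℝ) : ℂ) := by
    intro z
    simp only [hf]
    rw [integral_cexp_neg_mul_sq_norm_add (by norm_num)]
    push_cast
    rw [Complex.ofReal_cpow (by positivity)]
    congr 2
    · push_cast; ring
    · push_cast; ring
    · rw [mul_pow, I_sq]; ring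
  have hR : ∀ t, ∫ z, f z t ∂(μ.prod ν) =
      (Real.exp (-(1/2) * ‖t‖ ^ 2) : ℂ) * (charFun μ (s • t) * conj (charFun ν (s • t))) := by
    intro t
    rw [← charFun_neg, charFun_apply, charFun_apply, ← integral_prod_mul, ← integral_const_mul]
    congr 1
    ext z
    simp only [hf]
    push_cast
    rw [← Complex.exp_add, ← Complex.exp_add]
    congr 1
    simp only [inner_sub_left, inner_neg_right, inner_smul_right]
    push_cast
    ring
  simp_rw [hL, hR] at hsw
  rw [integral_complex_ofReal, integral_const_mul] at hsw
  have h2 := congrArg Complex.re hsw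
  rw [Complex.ofReal_re] at h2
  rw [h2]
  have hi : Integrable (fun t => (Real.exp (-(1/2) * ‖t‖ ^ 2) : ℂ) *
      (charFun μ (s • t) * conj (charFun ν (s • t)))) := by
    have := hint.integral_prod_right
    simp only [Function.uncurry_apply_pair] at this
    simpa only [hR] using this
  have h3 := (integral_re hi).symm
  simp only [RCLike.re_to_complex] at h3
  rw [h3]
  congr 1
  ext t
  rw [Complex.re_ofReal_mul]

open Complex ComplexConjugate in
theorem gini_F (μ ν : Measure E) [IsProbabilityMeasure μ] [IsProbabilityMeasure ν] (s : ℝ) :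
    (2 * Real.pi) ^ (Module.finrank ℝ E / 2 : ℝ) *
      (∫ z, Real.exp (-(s * ‖z.1 - z.2‖) ^ 2 / 2) ∂(μ.prod μ) +
       ∫ z, Real.exp (-(s * ‖z.1 - z.2‖) ^ 2 / 2) ∂(ν.prod ν) -
       2 * ∫ z, Real.exp (-(s * ‖z.1 - z.2‖) ^ 2 / 2) ∂(μ.prod ν)) =
    ∫ t : E, Real.exp (-(1/2) * ‖t‖ ^ 2) * ‖charFun μ (s • t) - charFun ν (s • t)‖ ^ 2 ∧
    Integrable (fun t : E =>
      Real.exp (-(1/2) * ‖t‖ ^ 2) * ‖charFun μ (s • t) - charFun ν (s • t)‖ ^ 2) := by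
  have hi : ∀ (μ ν : Measure E) [IsProbabilityMeasure μ] [IsProbabilityMeasure ν],
      Integrable (fun t : E => Real.exp (-(1/2) * ‖t‖ ^ 2) *
        (charFun μ (s • t) * conj (charFun ν (s • t))).re) := by
    intro μ ν _ _
    refine Integrable.mono' (gini_gauss_int (E := E)) (Continuous.aestronglyMeasurable ?_)
      (Filter.Eventually.of_forall fun t => ?_)
    · have h1 : Continuous (charFun μ) := continuous_charFun
      have h2 : Continuous (charFun ν) := continuous_charFun
      have := Complex.continuous_conj
      have := Complex.continuous_re
      fun_prop
    · rw [norm_mul, Real.norm_of_nonneg (Real.exp_pos _).le]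
      refine mul_le_of_le_one_right (Real.exp_pos _).le ?_
      refine (Complex.abs_re_le_norm _).trans ?_
      rw [norm_mul, RCLike.norm_conj]
      exact mul_le_one₀ (norm_charFun_le_one _) (norm_nonneg _) (norm_charFun_le_one _)
  have hpt : ∀ t : E, Real.exp (-(1/2) * ‖t‖ ^ 2) * ‖charFun μ (s • t) - charFun ν (s • t)‖ ^ 2 =
      Real.exp (-(1/2) * ‖t‖ ^ 2) * (charFun μ (s • t) * conj (charFun μ (s • t))).re +
      Real.exp (-(1/2) * ‖t‖ ^ 2) * (charFun ν (s • t) * conj (charFun ν (s • t))).re -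
      2 * (Real.exp (-(1/2) * ‖t‖ ^ 2) * (charFun μ (s • t) * conj (charFun ν (s • t))).re) := by
    intro t
    rw [← Complex.normSq_eq_norm_sq, Complex.normSq_apply]
    simp only [Complex.mul_re, Complex.sub_re, Complex.sub_im, Complex.conj_re, Complex.conj_im]
    ring
  simp_rw [hpt]
  refine ⟨?_, ((hi μ μ).add (hi ν ν)).sub ((hi μ ν).const_mul 2)⟩
  rw [gini_lin1 (hi μ μ) (hi ν ν) (hi μ ν), ← gini_fourier, ← gini_fourier, ← gini_fourier]
  ring

theorem gini_F_nonneg (μ ν : Measure E) [IsProbabilityMeasure μ] [IsProbabilityMeasure ν] (s : ℝ) :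
    0 ≤ ∫ z, Real.exp (-(s * ‖z.1 - z.2‖) ^ 2 / 2) ∂(μ.prod μ) +
       ∫ z, Real.exp (-(s * ‖z.1 - z.2‖) ^ 2 / 2) ∂(ν.prod ν) -
       2 * ∫ z, Real.exp (-(s * ‖z.1 - z.2‖) ^ 2 / 2) ∂(μ.prod ν) := by
  have h := (gini_F μ ν s).1
  have hc : 0 < (2 * Real.pi) ^ (Module.finrank ℝ E / 2 : ℝ) := by positivity
  refine nonneg_of_mul_nonneg_right (h ▸ ?_) hc
  exact integral_nonneg fun t => by positivity

theorem gini_F_eq (μ ν : Measure E) [IsProbabilityMeasure μ] [IsProbabilityMeasure ν] (s : ℝ)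
    (hs : 0 < s)
    (h0 : ∫ z, Real.exp (-(s * ‖z.1 - z.2‖) ^ 2 / 2) ∂(μ.prod μ) +
       ∫ z, Real.exp (-(s * ‖z.1 - z.2‖) ^ 2 / 2) ∂(ν.prod ν) -
       2 * ∫ z, Real.exp (-(s * ‖z.1 - z.2‖) ^ 2 / 2) ∂(μ.prod ν) = 0) : μ = ν := by
  obtain ⟨h, hi⟩ := gini_F μ ν s
  rw [h0, mul_zero, eq_comm, integral_eq_zero_iff_of_nonneg (fun t => by positivity) hi] at h
  have h1 : Continuous (charFun μ) := continuous_charFun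
  have h2 : Continuous (charFun ν) := continuous_charFun
  rw [Continuous.ae_eq_iff_eq volume (by fun_prop) (by exact continuous_const)] at h
  apply Measure.ext_of_charFun
  ext t
  have := congrFun h (s⁻¹ • t)
  simp only [Pi.zero_apply, mul_eq_zero, (Real.exp_pos _).ne', false_or, smul_smul,
    mul_inv_cancel₀ hs.ne', one_smul] at this
  exact sub_eq_zero.1 (norm_eq_zero.1 (pow_eq_zero_iff two_ne_zero |>.1 this))

theorem gini_int (α : ℝ) (hα : 0 < α) (μ ν : Measure E)
    [IsProbabilityMeasure μ] [IsProbabilityMeasure ν]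
    (hμ : Integrable (fun x => ‖x‖ ^ α) μ) (hν : Integrable (fun x => ‖x‖ ^ α) ν) :
    Integrable (fun z : E × E => ‖z.1 - z.2‖ ^ α) (μ.prod ν) := by
  have h := ((hμ.comp_fst ν).add (hν.comp_snd μ)).const_mul (2 ^ α)
  refine Integrable.mono' h (Measurable.aestronglyMeasurable (by fun_prop)) (Filter.Eventually.of_forall fun z => ?_)
  rw [Real.norm_of_nonneg (by positivity)]
  simp only [Pi.add_apply]
  have h1 : ‖z.1 - z.2‖ ≤ 2 * max ‖z.1‖ ‖z.2‖ := by
    have := norm_sub_le z.1 z.2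
    have := le_max_left ‖z.1‖ ‖z.2‖
    have := le_max_right ‖z.1‖ ‖z.2‖
    linarith
  calc ‖z.1 - z.2‖ ^ α ≤ (2 * max ‖z.1‖ ‖z.2‖) ^ α := by gcongr
    _ = 2 ^ α * (max ‖z.1‖ ‖z.2‖) ^ α := Real.mul_rpow (by norm_num) (by positivity)
    _ ≤ _ := by
      gcongr
      have a1 : 0 ≤ ‖z.1‖ ^ α := by positivity
      have a2 : 0 ≤ ‖z.2‖ ^ α := by positivity
      rcases max_cases ‖z.1‖ ‖z.2‖ with h | h <;> rw [h.1] <;> linarith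

theorem gini_delta_prod (α : ℝ) (hα : 0 < α) (μ ν : Measure E)
    [IsProbabilityMeasure μ] [IsProbabilityMeasure ν]
    (hμ : Integrable (fun x => ‖x‖ ^ α) μ) (hν : Integrable (fun x => ‖x‖ ^ α) ν) :
    giniDelta α μ ν = ∫ z, ‖z.1 - z.2‖ ^ α ∂(μ.prod ν) :=
  (integral_prod _ (gini_int α hα μ ν hμ hν)).symm

theorem gini_mix (α : ℝ) (hα : 0 < α) (hα2 : α < 2) (μ ν : Measure E)
    [IsProbabilityMeasure μ] [IsProbabilityMeasure ν]
    (hμ : Integrable (fun x => ‖x‖ ^ α) μ) (hν : Integrable (fun x => ‖x‖ ^ α) ν) :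
    IntegrableOn (fun s : ℝ => (1 - ∫ z, Real.exp (-(s * ‖z.1 - z.2‖) ^ 2 / 2) ∂(μ.prod ν)) *
      s ^ (-1 - α)) (Set.Ioi 0) ∧
    giniC α * giniDelta α μ ν =
      ∫ s in Set.Ioi (0 : ℝ), (1 - ∫ z, Real.exp (-(s * ‖z.1 - z.2‖) ^ 2 / 2) ∂(μ.prod ν)) *
        s ^ (-1 - α) := by
  set f : E × E → ℝ → ℝ := fun z s =>
    (1 - Real.exp (-(s * ‖z.1 - z.2‖) ^ 2 / 2)) * s ^ (-1 - α) with hf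
  have hm : Measurable (Function.uncurry f) := by
    simp only [hf, Function.uncurry_def]; fun_prop
  have hnn : ∀ z, ∀ s ∈ Set.Ioi (0 : ℝ), 0 ≤ f z s := by
    intro z s hs
    have hs0 : 0 < s := hs
    have h3 : Real.exp (-(s * ‖z.1 - z.2‖) ^ 2 / 2) ≤ 1 :=
      Real.exp_le_one_iff.2 (by have := sq_nonneg (s * ‖z.1 - z.2‖); linarith)
    exact mul_nonneg (by linarith) (by positivity)
  have hint : Integrable (Function.uncurry f)
      ((μ.prod ν).prod (volume.restrict (Set.Ioi (0 : ℝ)))) := by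
    rw [integrable_prod_iff hm.aestronglyMeasurable]
    refine ⟨Filter.Eventually.of_forall fun z => ?_, ?_⟩
    · exact (gini_scalar α hα hα2 ‖z.1 - z.2‖ (norm_nonneg _)).1
    have : ∀ z, ∫ s in Set.Ioi (0 : ℝ), ‖Function.uncurry f (z, s)‖ =
        giniC α * ‖z.1 - z.2‖ ^ α := by
      intro z
      rw [← (gini_scalar α hα hα2 _ (norm_nonneg (z.1 - z.2))).2]
      refine setIntegral_congr_fun measurableSet_Ioi fun s hs => ?_
      have h7 := hnn z s hs
      change ‖f z s‖ = f z s
      rw [Real.norm_of_nonneg h7]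
    simp_rw [this]
    exact (gini_int α hα μ ν hμ hν).const_mul _
  have hR : ∀ s, ∫ z, f z s ∂(μ.prod ν) =
      (1 - ∫ z, Real.exp (-(s * ‖z.1 - z.2‖) ^ 2 / 2) ∂(μ.prod ν)) * s ^ (-1 - α) := by
    intro s
    simp only [hf]
    rw [integral_mul_const, integral_sub (integrable_const _)]
    · simp
    · refine Integrable.mono' (integrable_const (1 : ℝ)) (by fun_prop)
        (Filter.Eventually.of_forall fun z => ?_)
      rw [Real.norm_of_nonneg (Real.exp_pos _).le]
      exact Real.exp_le_one_iff.2 (by have := sq_nonneg (s * ‖z.1 - z.2‖); linarith)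
  have hsw := integral_integral_swap hint
  have hL : ∀ z, ∫ s in Set.Ioi (0 : ℝ), f z s = giniC α * ‖z.1 - z.2‖ ^ α := fun z =>
    (gini_scalar α hα hα2 _ (norm_nonneg (z.1 - z.2))).2
  constructor
  · have := hint.integral_prod_right
    simp only [Function.uncurry_apply_pair, hR] at this
    exact this
  · simp_rw [hL, hR] at hsw
    rw [integral_const_mul, ← gini_delta_prod α hα μ ν hμ hν] at hsw
    exact hsw

theorem gini_energy (α : ℝ) (hα : 0 < α) (hα2 : α < 2) (μ ν : Measure E)
    [IsProbabilityMeasure μ] [IsProbabilityMeasure ν]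
    (hμ : Integrable (fun x => ‖x‖ ^ α) μ) (hν : Integrable (fun x => ‖x‖ ^ α) ν) :
    0 ≤ 2 * giniDelta α μ ν - giniDelta α μ μ - giniDelta α ν ν ∧
    (2 * giniDelta α μ ν - giniDelta α μ μ - giniDelta α ν ν = 0 → μ = ν) := by
  obtain ⟨i1, e1⟩ := gini_mix α hα hα2 μ ν hμ hν
  obtain ⟨i2, e2⟩ := gini_mix α hα hα2 μ μ hμ hμ
  obtain ⟨i3, e3⟩ := gini_mix α hα hα2 ν ν hν hν
  set F : ℝ → ℝ := fun s => (∫ z, Real.exp (-(s * ‖z.1 - z.2‖) ^ 2 / 2) ∂(μ.prod μ) +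
       ∫ z, Real.exp (-(s * ‖z.1 - z.2‖) ^ 2 / 2) ∂(ν.prod ν) -
       2 * ∫ z, Real.exp (-(s * ‖z.1 - z.2‖) ^ 2 / 2) ∂(μ.prod ν)) * s ^ (-1 - α) with hF
  have hFe : F = fun s => 2 * ((1 - ∫ z, Real.exp (-(s * ‖z.1 - z.2‖) ^ 2 / 2) ∂(μ.prod ν)) *
      s ^ (-1 - α)) - (1 - ∫ z, Real.exp (-(s * ‖z.1 - z.2‖) ^ 2 / 2) ∂(μ.prod μ)) *
      s ^ (-1 - α) - (1 - ∫ z, Real.exp (-(s * ‖z.1 - z.2‖) ^ 2 / 2) ∂(ν.prod ν)) *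
      s ^ (-1 - α) := by
    ext s; simp only [hF]; ring
  have hFi : IntegrableOn F (Set.Ioi 0) := by
    rw [hFe]; exact ((i1.const_mul 2).sub i2).sub i3
  have hFI : giniC α * (2 * giniDelta α μ ν - giniDelta α μ μ - giniDelta α ν ν) =
      ∫ s in Set.Ioi (0 : ℝ), F s := by
    rw [hFe, gini_lin2 i1 i2 i3, ← e1, ← e2, ← e3]
    ring
  have hFn : 0 ≤ᵐ[volume.restrict (Set.Ioi (0 : ℝ))] F := by
    filter_upwards [ae_restrict_mem measurableSet_Ioi] with s hs
    have hs0 : 0 < s := hs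
    exact mul_nonneg (gini_F_nonneg μ ν s) (by positivity)
  have hC := giniC_pos α hα hα2
  constructor
  · refine nonneg_of_mul_nonneg_right (hFI ▸ ?_) hC
    exact integral_nonneg_of_ae hFn
  · intro h0
    rw [h0, mul_zero, eq_comm, integral_eq_zero_iff_of_nonneg_ae hFn hFi] at hFI
    have : (volume.restrict (Set.Ioi (0 : ℝ))) ≠ 0 := by
      rw [Ne, Measure.restrict_eq_zero]; simp
    have : (ae (volume.restrict (Set.Ioi (0 : ℝ)))).NeBot := ae_neBot.2 this
    obtain ⟨s, hs, hs0⟩ := (hFI.and (ae_restrict_mem measurableSet_Ioi)).exists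
    have hs0 : 0 < s := hs0
    have hp : 0 < s ^ (-1 - α) := by positivity
    refine gini_F_eq μ ν s hs0 ?_
    simpa [hF, hp.ne'] using hs

theorem gini_delta_mix (α : ℝ) (hα : 0 < α)
    (K : ℕ) (p : Fin K → ℝ) (hp : ∀ k, 0 < p k)
    (μs : Fin K → Measure E) [∀ k, IsProbabilityMeasure (μs k)]
    (hmom : ∀ k, Integrable (fun x => ‖x‖ ^ α) (μs k)) :
    giniDelta α (∑ j, ENNReal.ofReal (p j) • μs j) (∑ j, ENNReal.ofReal (p j) • μs j) =
      ∑ j, ∑ k, p j * p k * giniDelta α (μs j) (μs k) := by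
  have hin : ∀ x k, Integrable (fun y => ‖x - y‖ ^ α) (μs k) := by
    intro x k
    have hx : Integrable (fun z : E => ‖z‖ ^ α) (Measure.dirac x) :=
      integrable_dirac (by simp)
    have := (gini_int α hα (Measure.dirac x) (μs k) hx (hmom k)).prod_right_ae
    rw [ae_dirac_eq] at this
    exact this
  have hI : ∀ x, ∫ y, ‖x - y‖ ^ α ∂(∑ j, ENNReal.ofReal (p j) • μs j) =
      ∑ k, p k * ∫ y, ‖x - y‖ ^ α ∂(μs k) := by
    intro x
    rw [integral_finsetSum_measure]
    · refine Finset.sum_congr rfl fun k _ => ?_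
      rw [integral_smul_measure, ENNReal.toReal_ofReal (hp k).le, smul_eq_mul]
    · intro k _
      exact (hin x k).smul_measure ENNReal.ofReal_ne_top
  have hout : ∀ j k, Integrable (fun x => ∫ y, ‖x - y‖ ^ α ∂(μs k)) (μs j) := fun j k =>
    (gini_int α hα (μs j) (μs k) (hmom j) (hmom k)).integral_prod_left
  have hout2 : ∀ j, Integrable (fun x => ∑ k, p k * ∫ y, ‖x - y‖ ^ α ∂(μs k)) (μs j) := fun j =>
    integrable_finsetSum _ fun k _ => (hout j k).const_mul _
  rw [giniDelta]
  simp_rw [hI]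
  rw [integral_finsetSum_measure]
  · refine Finset.sum_congr rfl fun j _ => ?_
    rw [integral_smul_measure, ENNReal.toReal_ofReal (hp j).le, smul_eq_mul,
      integral_finsetSum _ fun k _ => (hout j k).const_mul _, Finset.mul_sum]
    refine Finset.sum_congr rfl fun k _ => ?_
    rw [integral_const_mul, giniDelta]
    ring
  · intro j _
    exact (hout2 j).smul_measure ENNReal.ofReal_ne_top

end

/-- For `0 < α < 2` and a mixture `μ = Σ p_k μ_k` of probability measures on
`ℝ^d` with finite `α`-th moments, the Gini distance covariance
`gCov(α) = Δ(μ;α) − Σ_k p_k Δ(μ_k;α)` is zero if and only if `μ_k = μ` for every `k`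
(i.e. the Gini correlation characterizes independence). -/
theorem gcov_eq_zero_iff_independent
    (d : ℕ) (α : ℝ) (hα : 0 < α) (hα2 : α < 2)
    (K : ℕ) (hK : 2 ≤ K) (p : Fin K → ℝ) (hp : ∀ k, 0 < p k) (hsum : ∑ k, p k = 1)
    (μs : Fin K → Measure (EuclideanSpace ℝ (Fin d))) [∀ k, IsProbabilityMeasure (μs k)]
    (hmom : ∀ k, Integrable (fun x => ‖x‖ ^ α) (μs k)) :
    giniDelta α (∑ j, ENNReal.ofReal (p j) • μs j) (∑ j, ENNReal.ofReal (p j) • μs j)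
        - (∑ k, p k * giniDelta α (μs k) (μs k)) = 0
      ↔ ∀ k, μs k = ∑ j, ENNReal.ofReal (p j) • μs j := by
  constructor
  · intro h
    rw [gini_delta_mix α hα K p hp μs hmom] at h
    have hE := fun j k => gini_energy α hα hα2 (μs j) (μs k) (hmom j) (hmom k)
    have hnn : ∀ j k, 0 ≤ p j * p k * (2 * giniDelta α (μs j) (μs k) - giniDelta α (μs j) (μs j)
        - giniDelta α (μs k) (μs k)) := fun j k =>
      mul_nonneg (mul_pos (hp j) (hp k)).le (hE j k).1
    have hA : ∑ j, ∑ k, p j * p k * giniDelta α (μs j) (μs j) =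
        ∑ k, p k * giniDelta α (μs k) (μs k) := by
      refine Finset.sum_congr rfl fun j _ => ?_
      rw [← Finset.sum_mul, ← Finset.mul_sum, hsum, mul_one]
    have hB : ∑ j, ∑ k, p j * p k * giniDelta α (μs k) (μs k) =
        ∑ k, p k * giniDelta α (μs k) (μs k) := by
      rw [Finset.sum_comm]
      refine Finset.sum_congr rfl fun k _ => ?_
      rw [← Finset.sum_mul, ← Finset.sum_mul, hsum, one_mul]
    have hS : ∑ j, ∑ k, p j * p k * (2 * giniDelta α (μs j) (μs k) - giniDelta α (μs j) (μs j)
        - giniDelta α (μs k) (μs k)) = 0 := by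
      have : ∀ j k, p j * p k * (2 * giniDelta α (μs j) (μs k) - giniDelta α (μs j) (μs j)
          - giniDelta α (μs k) (μs k)) = 2 * (p j * p k * giniDelta α (μs j) (μs k)) -
          p j * p k * giniDelta α (μs j) (μs j) - p j * p k * giniDelta α (μs k) (μs k) := by
        intro j k; ring
      simp_rw [this, Finset.sum_sub_distrib, ← Finset.mul_sum]
      rw [hA, hB]
      linarith
    have heq : ∀ j k, μs j = μs k := by
      intro j k
      have h1 := (Finset.sum_eq_zero_iff_of_nonneg
        (fun j _ => Finset.sum_nonneg fun k _ => hnn j k)).1 hS j (Finset.mem_univ j)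
      have h2 := (Finset.sum_eq_zero_iff_of_nonneg (fun k _ => hnn j k)).1 h1 k (Finset.mem_univ k)
      exact (hE j k).2 ((mul_eq_zero.1 h2).resolve_left (mul_pos (hp j) (hp k)).ne')
    intro k
    have : ∀ j, ENNReal.ofReal (p j) • μs j = ENNReal.ofReal (p j) • μs k := fun j => by
      rw [heq j k]
    simp_rw [this]
    rw [← Finset.sum_smul, ← ENNReal.ofReal_sum_of_nonneg fun j _ => (hp j).le, hsum]
    simp
  · intro h
    have : ∀ k, p k * giniDelta α (μs k) (μs k) = p k * giniDelta α
        (∑ j, ENNReal.ofReal (p j) • μs j) (∑ j, ENNReal.ofReal (p j) • μs j) := fun k => by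
      rw [← h k]
    rw [Finset.sum_congr rfl fun k _ => this k, ← Finset.sum_mul, hsum, one_mul, sub_self]
end

section
/- Let K ≥ 2, let p_1,…,p_K > 0 with Σ_{k=1}^K p_k = 1, let μ_1,…,μ_K be probability measures on ℝ with finite first moments and cumulative distribution functions F_1,…,F_K, and let μ := Σ_{k=1}^K p_k μ_k have cumulative distribution function F. Then the distance covariance between the numerical variable and the categorical label satisfies dCov(X,Y;1) := Σ_{k=1}^K p_k² T(μ_k,μ;1) = 2 Σ_{k=1}^K ∫_ℝ (p_k F_k(x) − p_k F(x))² dx. -/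
open MeasureTheory ProbabilityTheory
open scoped ENNReal BigOperators

noncomputable def hIco (z : ℝ × ℝ) (t : ℝ) : ℝ :=
  (Set.Iic t).indicator (fun _ => (1 : ℝ)) z.1 + (Set.Iic t).indicator (fun _ => (1 : ℝ)) z.2
    - 2 * ((Set.Iic t).indicator (fun _ => (1 : ℝ)) z.1
        * (Set.Iic t).indicator (fun _ => (1 : ℝ)) z.2)

lemma hIco_eq (z : ℝ × ℝ) (t : ℝ) :
    hIco z t = (Set.Ico (min z.1 z.2) (max z.1 z.2)).indicator (fun _ => (1 : ℝ)) t := by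
  unfold hIco
  simp only [Set.indicator_apply, Set.mem_Iic, Set.mem_Ico, min_le_iff, lt_max_iff]
  by_cases h1 : z.1 ≤ t <;> by_cases h2 : z.2 ≤ t <;> simp [h1, h2, not_le.mp, not_lt.mpr] <;>
    norm_num

lemma hIco_meas : Measurable (fun q : (ℝ × ℝ) × ℝ => hIco q.1 q.2) := by
  have e1 : Measurable (fun q : (ℝ × ℝ) × ℝ =>
      (Set.Iic q.2).indicator (fun _ => (1 : ℝ)) q.1.1) := by
    have : (fun q : (ℝ × ℝ) × ℝ => (Set.Iic q.2).indicator (fun _ => (1 : ℝ)) q.1.1)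
        = {q : (ℝ × ℝ) × ℝ | q.1.1 ≤ q.2}.indicator (fun _ => (1 : ℝ)) := by
      ext q; simp [Set.indicator_apply]
    rw [this]
    exact measurable_const.indicator (measurableSet_le (by fun_prop) (by fun_prop))
  have e2 : Measurable (fun q : (ℝ × ℝ) × ℝ =>
      (Set.Iic q.2).indicator (fun _ => (1 : ℝ)) q.1.2) := by
    have : (fun q : (ℝ × ℝ) × ℝ => (Set.Iic q.2).indicator (fun _ => (1 : ℝ)) q.1.2)
        = {q : (ℝ × ℝ) × ℝ | q.1.2 ≤ q.2}.indicator (fun _ => (1 : ℝ)) := by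
      ext q; simp [Set.indicator_apply]
    rw [this]
    exact measurable_const.indicator (measurableSet_le (by fun_prop) (by fun_prop))
  unfold hIco
  exact (e1.add e2).sub ((e1.mul e2).const_mul 2)

lemma hIco_integrable (z : ℝ × ℝ) : Integrable (hIco z) := by
  have : hIco z = (Set.Ico (min z.1 z.2) (max z.1 z.2)).indicator (fun _ => (1 : ℝ)) :=
    funext (hIco_eq z)
  rw [this, integrable_indicator_iff measurableSet_Ico]
  exact integrableOn_const (by simp)

lemma hIco_integral (z : ℝ × ℝ) : ∫ t, hIco z t = ‖z.1 - z.2‖ := by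
  simp only [hIco_eq]
  rw [integral_indicator measurableSet_Ico]
  simp [max_sub_min_eq_abs', Measure.real]

lemma hIco_norm (z : ℝ × ℝ) (t : ℝ) : ‖hIco z t‖ = hIco z t := by
  rw [Real.norm_of_nonneg]
  rw [hIco_eq]
  exact Set.indicator_nonneg (fun _ _ => zero_le_one) _

lemma hIco_fiber (μ ν : Measure ℝ) [IsProbabilityMeasure μ] [IsProbabilityMeasure ν] (t : ℝ) :
    ∫ z, hIco z t ∂(μ.prod ν) = cdf μ t + cdf ν t - 2 * (cdf μ t * cdf ν t) := by
  have i1 : ∀ (ρ : Measure ℝ) [IsProbabilityMeasure ρ],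
      Integrable ((Set.Iic t).indicator (fun _ => (1 : ℝ))) ρ := fun ρ _ =>
    (integrable_const 1).indicator measurableSet_Iic
  have v : ∀ (ρ : Measure ℝ) [IsProbabilityMeasure ρ],
      ∫ x, (Set.Iic t).indicator (fun _ => (1 : ℝ)) x ∂ρ = cdf ρ t := fun ρ _ => by
    rw [integral_indicator measurableSet_Iic, cdf_eq_real]; simp
  have a := (i1 μ).comp_fst ν
  have b := (i1 ν).comp_snd μ
  have c := (i1 μ).mul_prod (i1 ν)
  unfold hIco
  have ab : Integrable (fun z : ℝ × ℝ => (Set.Iic t).indicator (fun _ => (1 : ℝ)) z.1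
      + (Set.Iic t).indicator (fun _ => (1 : ℝ)) z.2) (μ.prod ν) := a.add b
  rw [integral_sub ab (c.const_mul 2), integral_add a b, integral_const_mul,
    integral_prod_mul, integral_fun_fst, integral_fun_snd, v, v]
  simp

lemma gini_eq (μ ν : Measure ℝ) [IsProbabilityMeasure μ] [IsProbabilityMeasure ν]
    (hμ : Integrable (fun x => |x|) μ) (hν : Integrable (fun x => |x|) ν) :
    Integrable (fun t => cdf μ t + cdf ν t - 2 * (cdf μ t * cdf ν t)) ∧
    giniDelta 1 μ ν = ∫ t, (cdf μ t + cdf ν t - 2 * (cdf μ t * cdf ν t)) := by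
  have hμ' : Integrable (fun x : ℝ => x) μ := (integrable_norm_iff (by fun_prop)).mp hμ
  have hν' : Integrable (fun x : ℝ => x) ν := (integrable_norm_iff (by fun_prop)).mp hν
  have hd : Integrable (fun z : ℝ × ℝ => ‖z.1 - z.2‖) (μ.prod ν) :=
    ((hμ'.comp_fst ν).sub (hν'.comp_snd μ)).norm
  have hi : Integrable (fun q : (ℝ × ℝ) × ℝ => hIco q.1 q.2) ((μ.prod ν).prod volume) := by
    rw [integrable_prod_iff hIco_meas.aestronglyMeasurable]
    refine ⟨Filter.Eventually.of_forall fun z => hIco_integrable z, ?_⟩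
    simpa only [hIco_norm, hIco_integral] using hd
  have h2 := hi.integral_prod_right
  simp only [hIco_fiber] at h2
  refine ⟨h2, ?_⟩
  have h3 := integral_integral_swap (f := hIco) hi
  simp only [hIco_fiber, hIco_integral] at h3
  rw [← h3, integral_prod _ hd]
  simp [giniDelta]

lemma energy_eq (μ ν : Measure ℝ) [IsProbabilityMeasure μ] [IsProbabilityMeasure ν]
    (hμ : Integrable (fun x => |x|) μ) (hν : Integrable (fun x => |x|) ν) :
    energyDist 1 μ ν = 2 * ∫ t, (cdf μ t - cdf ν t) ^ 2 := by
  obtain ⟨a, a'⟩ := gini_eq μ ν hμ hν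
  obtain ⟨b, b'⟩ := gini_eq μ μ hμ hμ
  obtain ⟨c, c'⟩ := gini_eq ν ν hν hν
  rw [energyDist, a', b', c', ← integral_const_mul, ← integral_const_mul,
    ← integral_sub (a.const_mul 2) b]
  have h := integral_sub ((a.const_mul 2).sub b) c
  simp only [Pi.sub_apply] at h
  rw [← h]
  congr 1
  ext t
  ring

/-- For a mixture `μ = Σ p_k μ_k` of probability measures on `ℝ` with finite
first moments, the distance covariance between the numerical variable and the class label
satisfies `dCov(X,Y;1) = Σ_k p_k² T(μ_k,μ;1) = 2 Σ_k ∫ (p_k F_k(x) − p_k F(x))² dx`. -/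
theorem dcov_eq_cdf_L2
    (K : ℕ) (hK : 2 ≤ K) (p : Fin K → ℝ) (hp : ∀ k, 0 < p k) (hsum : ∑ k, p k = 1)
    (μs : Fin K → Measure ℝ) [∀ k, IsProbabilityMeasure (μs k)]
    (hmom : ∀ k, Integrable (fun x => |x|) (μs k)) :
    ∑ k, (p k) ^ 2 * energyDist 1 (μs k) (∑ j, ENNReal.ofReal (p j) • μs j)
      = 2 * ∑ k, ∫ x,
          (p k * cdf (μs k) x - p k * cdf (∑ j, ENNReal.ofReal (p j) • μs j) x) ^ 2 := by
  have hprob : IsProbabilityMeasure (∑ j, ENNReal.ofReal (p j) • μs j) := by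
    constructor
    simp only [Measure.coe_finsetSum, Finset.sum_apply, Measure.smul_apply, measure_univ,
      smul_eq_mul, mul_one]
    rw [← ENNReal.ofReal_sum_of_nonneg (fun i _ => (hp i).le), hsum, ENNReal.ofReal_one]
  have hint : Integrable (fun x => |x|) (∑ j, ENNReal.ofReal (p j) • μs j) := by
    rw [integrable_finsetSum_measure]
    exact fun i _ => (hmom i).smul_measure ENNReal.ofReal_ne_top
  rw [Finset.mul_sum]
  refine Finset.sum_congr rfl fun k _ => ?_
  rw [energy_eq _ _ (hmom k) hint]
  simp only [← mul_sub, mul_pow]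
  rw [integral_const_mul]
  ring
end
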